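/- arXiv:2112.13831 — 3 statements merged into one kernel-verified Lean document; each statement's English description precedes it below -/
import Mathlib

section
/- Let (X, μ) be a measure space and let f : X → [0, ∞) be measurable with μ({x : f(x) > s}) < ∞ for every s > 0. Let φ, ψ : [0, ∞) → [0, ∞) be nondecreasing continuously differentiable functions with φ(0) = 0 and ψ(0) = 0. Then, writing λ_f(s) = μ({x : f(x) > s}) and f_*(t) = inf{ s ≥ 0 : λ_f(s) ≤ t }, one has the identity of (possibly infinite) nonnegative integrals ∫₀^∞ φ(λ_f(t)) ψ'(t) dt = ∫₀^∞ φ'(t) ψ(f_*(t)) dt. -/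
open MeasureTheory Set

/-- The derivative of a monotone function on `[0, ∞)` is nonnegative. -/
lemma nonneg_of_hasDerivWithinAt_Ici {φ φ' : ℝ → ℝ} (hmono : MonotoneOn φ (Ici 0))
    (hderiv : ∀ t ∈ Ici (0:ℝ), HasDerivWithinAt φ (φ' t) (Ici 0) t) {t : ℝ} (ht : 0 < t) :
    0 ≤ φ' t := by
  have h := (hderiv t ht.le).derivWithin (uniqueDiffOn_Ici 0 t ht.le)
  rw [← h]
  exact hmono.derivWithin_nonneg

/-- The fundamental theorem of calculus on `[0, a]` as an identity of lower Lebesgue integrals. -/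
lemma ofReal_eq_setLIntegral_deriv {φ φ' : ℝ → ℝ} (hmono : MonotoneOn φ (Ici 0)) (h0 : φ 0 = 0)
    (hderiv : ∀ t ∈ Ici (0:ℝ), HasDerivWithinAt φ (φ' t) (Ici 0) t)
    (hcont : ContinuousOn φ' (Ici 0)) {a : ℝ} (ha : 0 ≤ a) :
    ENNReal.ofReal (φ a) = ∫⁻ u in Ioo 0 a, ENNReal.ofReal (φ' u) := by
  have hsub : Icc 0 a ⊆ Ici (0:ℝ) := fun x hx => hx.1
  have hint : IntervalIntegrable φ' volume 0 a :=
    (hcont.mono (by rwa [uIcc_of_le ha])).intervalIntegrable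
  have hftc : ∫ u in (0:ℝ)..a, φ' u = φ a := by
    rw [intervalIntegral.integral_eq_sub_of_hasDerivAt_of_le ha
      (fun x hx => ((hderiv x (hsub hx)).continuousWithinAt).mono hsub)
      (fun x hx => (hderiv x hx.1.le).hasDerivAt (Ici_mem_nhds hx.1)) hint, h0, sub_zero]
  rw [← hftc, intervalIntegral.integral_of_le ha, integral_Ioc_eq_integral_Ioo,
    ofReal_integral_eq_lintegral_ofReal]
  · exact ((intervalIntegrable_iff_integrableOn_Ioo_of_le ha).1 hint)
  · filter_upwards [ae_restrict_mem measurableSet_Ioo] with u hu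
    exact nonneg_of_hasDerivWithinAt_Ici hmono hderiv hu.1

section Rearrangement

variable {X : Type*} [MeasurableSpace X] {μ : Measure X} {f : X → ℝ}

/-- The distribution function is antitone. -/
lemma antitone_measure_lt (μ : Measure X) (f : X → ℝ) :
    Antitone fun s : ℝ => μ {x | s < f x} :=
  fun _ _ hab => measure_mono fun _ hx => hab.trans_lt hx

/-- The distribution function is lower semicontinuous from the right. -/
lemma exists_gt_lt_measure_lt {t : ℝ} {c : ENNReal} (h : c < μ {x | t < f x}) :
    ∃ s, t < s ∧ c < μ {x | s < f x} := by
  have hU : {x | t < f x} = ⋃ n : ℕ, {x | t + 1 / ((n : ℝ) + 1) < f x} := by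
    ext x
    simp only [mem_ofPred_eq, mem_iUnion]
    constructor
    · intro hx
      obtain ⟨n, hn⟩ := exists_nat_one_div_lt (sub_pos.2 hx)
      exact ⟨n, by linarith⟩
    · rintro ⟨n, hn⟩
      have : 0 < 1 / ((n : ℝ) + 1) := Nat.one_div_pos_of_nat
      linarith
  have hmono : Monotone fun n : ℕ => {x | t + 1 / ((n : ℝ) + 1) < f x} := by
    intro m n hmn x hx
    have := Nat.one_div_le_one_div (α := ℝ) hmn
    simp only [mem_ofPred_eq] at hx ⊢
    linarith
  rw [hU, hmono.measure_iUnion, lt_iSup_iff] at h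
  obtain ⟨n, hn⟩ := h
  exact ⟨_, lt_add_of_pos_right _ Nat.one_div_pos_of_nat, hn⟩

/-- The distribution function of a real-valued function is eventually below any positive level,
provided it is finite at positive levels. -/
lemma exists_nonneg_measure_lt_le (hf : Measurable f)
    (hfin : ∀ s : ℝ, 0 < s → μ {x | s < f x} < ⊤) {c : ENNReal} (hc : 0 < c) :
    ∃ s : ℝ, 0 ≤ s ∧ μ {x | s < f x} ≤ c := by
  have hI : ⋂ n : ℕ, {x | (n : ℝ) + 1 < f x} = ∅ := by
    refine eq_empty_of_forall_notMem fun x hx => ?_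
    obtain ⟨n, hn⟩ := exists_nat_ge (f x)
    have := mem_iInter.1 hx n
    simp only [mem_ofPred_eq] at this
    linarith
  have hanti : Antitone fun n : ℕ => {x | (n : ℝ) + 1 < f x} := by
    intro m n hmn x hx
    have : (m : ℝ) ≤ n := Nat.cast_le.2 hmn
    simp only [mem_ofPred_eq] at hx ⊢
    linarith
  have hlim := tendsto_measure_iInter_atTop (μ := μ)
    (fun n : ℕ => (measurableSet_lt (measurable_const (a := (n : ℝ) + 1)) hf).nullMeasurableSet)
    hanti ⟨0, (hfin _ (by positivity)).ne⟩
  rw [hI, measure_empty] at hlim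
  obtain ⟨n, hn⟩ := (hlim.eventually (gt_mem_nhds hc)).exists
  exact ⟨n + 1, by positivity, hn.le⟩

/-- The decreasing rearrangement is the generalized inverse of the distribution function. -/
lemma lt_rearrangement_iff (hf : Measurable f)
    (hfin : ∀ s : ℝ, 0 < s → μ {x | s < f x} < ⊤) {t : ℝ} (ht : 0 ≤ t) {c : ENNReal}
    (hc : 0 < c) :
    t < sInf {s : ℝ | 0 ≤ s ∧ μ {x | s < f x} ≤ c} ↔ c < μ {x | t < f x} := by
  constructor
  · intro h
    by_contra! hle
    exact h.not_ge (csInf_le ⟨0, fun s hs => hs.1⟩ ⟨ht, hle⟩)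
  · intro h
    obtain ⟨s, hts, hs⟩ := exists_gt_lt_measure_lt h
    refine hts.trans_le (le_csInf (exists_nonneg_measure_lt_le hf hfin hc) fun r hr => ?_)
    by_contra! hrs
    exact (hs.trans_le ((antitone_measure_lt μ f hrs.le).trans hr.2)).false

end Rearrangement

/-- Extending a continuous function on `[0, ∞)` by zero gives a measurable function. -/
lemma measurable_indicator_Ioi_ofReal {φ' : ℝ → ℝ} (hcont : ContinuousOn φ' (Ici 0)) :
    Measurable ((Ioi (0:ℝ)).indicator fun u => ENNReal.ofReal (φ' u)) := by
  have hm : Measurable fun u => ENNReal.ofReal (φ' (max u 0)) :=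
    ENNReal.measurable_ofReal.comp (hcont.comp_continuous (by fun_prop)
      fun u => le_max_right u 0).measurable
  convert hm.indicator (measurableSet_Ioi (a := (0:ℝ))) using 1
  refine indicator_congr fun u hu => ?_
  rw [max_eq_left (mem_Ioi.1 hu).le]

/-- For a measure space `(X, μ)`, a nonnegative measurable `f` whose
distribution function is finite for positive levels, and nondecreasing `C¹` functions
`φ, ψ : [0,∞) → [0,∞)` vanishing at `0`, one has
`∫₀^∞ φ(λ_f(t)) ψ'(t) dt = ∫₀^∞ φ'(t) ψ(f_*(t)) dt` as possibly infinite nonnegative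
integrals, where `λ_f(s) = μ {f > s}` and `f_*(t) = inf {s ≥ 0 : λ_f(s) ≤ t}`. -/
theorem stmt_0 {X : Type*} [MeasurableSpace X] (μ : Measure X)
    (f : X → ℝ) (hf : Measurable f) (hf0 : ∀ x, 0 ≤ f x)
    (hfin : ∀ s : ℝ, 0 < s → μ {x | s < f x} < ⊤)
    (φ ψ φ' ψ' : ℝ → ℝ)
    (hφmono : MonotoneOn φ (Ici 0)) (hψmono : MonotoneOn ψ (Ici 0))
    (hφnonneg : ∀ t ∈ Ici (0:ℝ), 0 ≤ φ t) (hψnonneg : ∀ t ∈ Ici (0:ℝ), 0 ≤ ψ t)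
    (hφ0 : φ 0 = 0) (hψ0 : ψ 0 = 0)
    (hφderiv : ∀ t ∈ Ici (0:ℝ), HasDerivWithinAt φ (φ' t) (Ici 0) t)
    (hψderiv : ∀ t ∈ Ici (0:ℝ), HasDerivWithinAt ψ (ψ' t) (Ici 0) t)
    (hφ'cont : ContinuousOn φ' (Ici 0)) (hψ'cont : ContinuousOn ψ' (Ici 0)) :
    ∫⁻ t in Ioi (0:ℝ), ENNReal.ofReal (φ ((μ {x | t < f x}).toReal) * ψ' t)
      = ∫⁻ t in Ioi (0:ℝ),
          ENNReal.ofReal (φ' t *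
            ψ (sInf {s : ℝ | 0 ≤ s ∧ μ {x | s < f x} ≤ ENNReal.ofReal t})) := by
  set g := (Ioi (0:ℝ)).indicator fun u => ENNReal.ofReal (φ' u) with hg
  set h := (Ioi (0:ℝ)).indicator fun t => ENNReal.ofReal (ψ' t) with hh
  have hgm : Measurable g := measurable_indicator_Ioi_ofReal hφ'cont
  have hhm : Measurable h := measurable_indicator_Ioi_ofReal hψ'cont
  set S : Set (ℝ × ℝ) := {p | ENNReal.ofReal p.2 < μ {x | p.1 < f x}} with hS
  have hSm : MeasurableSet S :=
    measurableSet_lt (ENNReal.measurable_ofReal.comp measurable_snd)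
      ((antitone_measure_lt μ f).measurable.comp measurable_fst)
  set F : ℝ × ℝ → ENNReal := S.indicator fun p => g p.2 * h p.1 with hF
  have hFm : Measurable F :=
    ((hgm.comp measurable_snd).mul (hhm.comp measurable_fst)).indicator hSm
  have hleft : ∀ t ∈ Ioi (0:ℝ), ENNReal.ofReal (φ ((μ {x | t < f x}).toReal) * ψ' t)
      = ∫⁻ u in Ioi (0:ℝ), F (t, u) := by
    intro t ht
    rw [ENNReal.ofReal_mul (hφnonneg _ ENNReal.toReal_nonneg),
      ofReal_eq_setLIntegral_deriv hφmono hφ0 hφderiv hφ'cont ENNReal.toReal_nonneg,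
      ← inter_eq_self_of_subset_left (Ioo_subset_Ioi_self (b := (0:ℝ))
        (a := (μ {x | t < f x}).toReal)),
      ← setLIntegral_indicator measurableSet_Ioo, ← lintegral_mul_const' _ _ ENNReal.ofReal_ne_top]
    refine setLIntegral_congr_fun measurableSet_Ioi fun u hu => ?_
    have hiff : u ∈ Ioo 0 (μ {x | t < f x}).toReal ↔ (t, u) ∈ S := by
      simp only [hS, mem_Ioo, mem_ofPred_eq,
        ENNReal.ofReal_lt_iff_lt_toReal (mem_Ioi.1 hu).le (hfin t ht).ne]
      exact and_iff_right hu
    by_cases hu' : (t, u) ∈ S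
    · simp only [hF, indicator_of_mem hu', indicator_of_mem (hiff.2 hu'), hg, hh,
        indicator_of_mem hu, indicator_of_mem ht]
    · simp only [hF, indicator_of_notMem hu', indicator_of_notMem (mt hiff.1 hu'), zero_mul]
  have hright : ∀ u ∈ Ioi (0:ℝ), ENNReal.ofReal (φ' u *
      ψ (sInf {s : ℝ | 0 ≤ s ∧ μ {x | s < f x} ≤ ENNReal.ofReal u}))
      = ∫⁻ t in Ioi (0:ℝ), F (t, u) := by
    intro u hu
    have hr : 0 ≤ sInf {s : ℝ | 0 ≤ s ∧ μ {x | s < f x} ≤ ENNReal.ofReal u} :=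
      Real.sInf_nonneg fun s hs => hs.1
    rw [ENNReal.ofReal_mul (nonneg_of_hasDerivWithinAt_Ici hφmono hφderiv hu),
      ofReal_eq_setLIntegral_deriv hψmono hψ0 hψderiv hψ'cont hr,
      ← inter_eq_self_of_subset_left (Ioo_subset_Ioi_self (b := (0:ℝ))
        (a := sInf {s : ℝ | 0 ≤ s ∧ μ {x | s < f x} ≤ ENNReal.ofReal u})),
      ← setLIntegral_indicator measurableSet_Ioo, ← lintegral_const_mul' _ _ ENNReal.ofReal_ne_top]
    refine setLIntegral_congr_fun measurableSet_Ioi fun t ht => ?_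
    have hiff : t ∈ Ioo 0 (sInf {s : ℝ | 0 ≤ s ∧ μ {x | s < f x} ≤ ENNReal.ofReal u}) ↔
        (t, u) ∈ S := by
      simp only [hS, mem_Ioo, mem_ofPred_eq,
        lt_rearrangement_iff hf hfin (mem_Ioi.1 ht).le (ENNReal.ofReal_pos.2 hu)]
      exact and_iff_right ht
    by_cases ht' : (t, u) ∈ S
    · simp only [hF, indicator_of_mem ht', indicator_of_mem (hiff.2 ht'), hg, hh,
        indicator_of_mem hu, indicator_of_mem ht]
    · simp only [hF, indicator_of_notMem ht', indicator_of_notMem (mt hiff.1 ht'), mul_zero]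
  rw [setLIntegral_congr_fun measurableSet_Ioi hleft,
    setLIntegral_congr_fun measurableSet_Ioi hright]
  exact lintegral_lintegral_swap (f := fun t u => F (t, u)) hFm.aemeasurable
end

section
/- Let x ∈ ℂ, r > 0, and let u : ℂ → [0, ∞) be continuous. Then there exists ρ ∈ (r, 2r) such that ρ² ∫₀^{2π} u(x + ρ e^{iθ}) dθ ≤ (1/log 2) ∫_{B(x,2r) \ B̄(x,r)} u dℒ²; equivalently, the circle of radius ρ about x satisfies ρ ∫_{∂B(x,ρ)} u dℋ¹ ≤ (log 2)^{-1} ∫_{B(x,2r) \ B̄(x,r)} u dℒ². -/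
open MeasureTheory

/-- Integration of a continuous function over an annulus in polar coordinates. -/
theorem Complex.setIntegral_annulus_eq_intervalIntegral {E : Type*} [NormedAddCommGroup E]
    [NormedSpace ℝ E] {f : ℂ → E} (hf : Continuous f) (c : ℂ) {r R : ℝ} (hr : 0 ≤ r)
    (hrR : r ≤ R) :
    ∫ z in Metric.ball c R \ Metric.closedBall c r, f z =
      ∫ ρ in r..R, ρ • ∫ θ in (0 : ℝ)..(2 * Real.pi), f (c + ρ * Complex.exp (θ * Complex.I)) := by
  have hmeas : MeasurableSet (Metric.ball c R \ Metric.closedBall c r) :=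
    measurableSet_ball.diff measurableSet_closedBall
  have hsymm (p : ℝ × ℝ) :
      Complex.polarCoord.symm p = p.1 * Complex.exp (p.2 * Complex.I) := by
    rw [Complex.polarCoord_symm_apply, Complex.exp_mul_I, Complex.ofReal_cos, Complex.ofReal_sin]
  let g : ℝ × ℝ → E := fun p ↦ p.1 • f (c + p.1 * Complex.exp (p.2 * Complex.I))
  have hg : Continuous g := by fun_prop
  have hint : IntegrableOn g (Set.Ioo r R ×ˢ Set.Ioo (-Real.pi) Real.pi)
      ((volume : Measure ℝ).prod volume) :=
    (hg.continuousOn.integrableOn_compact (isCompact_Icc.prod isCompact_Icc)).mono_set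
      (Set.prod_mono Set.Ioo_subset_Icc_self Set.Ioo_subset_Icc_self)
  rw [← integral_indicator hmeas, ← integral_add_left_eq_self _ c,
    ← Complex.integral_comp_polarCoord_symm, polarCoord_target]
  have hcongr : ∀ p ∈ Set.Ioi (0 : ℝ) ×ˢ Set.Ioo (-Real.pi) Real.pi,
      p.1 • (Metric.ball c R \ Metric.closedBall c r).indicator f
        (c + Complex.polarCoord.symm p) =
      (Set.Ioo r R ×ˢ Set.Ioo (-Real.pi) Real.pi).indicator g p := by
    rintro ⟨ρ, θ⟩ ⟨hρ, hθ⟩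
    have hmem : c + Complex.polarCoord.symm (ρ, θ) ∈ Metric.ball c R \ Metric.closedBall c r ↔
        (ρ, θ) ∈ Set.Ioo r R ×ˢ Set.Ioo (-Real.pi) Real.pi := by
      have hn : ‖Complex.polarCoord.symm (ρ, θ)‖ = ρ := by
        rw [Complex.norm_polarCoord_symm, abs_of_pos hρ]
      simp only [Set.mem_sdiff, Metric.mem_ball, Metric.mem_closedBall, dist_self_add_left, hn,
        not_le, Set.mem_prod, Set.mem_Ioo]
      exact ⟨fun h ↦ ⟨⟨h.2, h.1⟩, hθ⟩, fun h ↦ ⟨h.1.2, h.1.1⟩⟩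
    by_cases h : (ρ, θ) ∈ Set.Ioo r R ×ˢ Set.Ioo (-Real.pi) Real.pi
    · rw [Set.indicator_of_mem h, Set.indicator_of_mem (hmem.2 h), hsymm]
    · rw [Set.indicator_of_notMem h, Set.indicator_of_notMem (mt hmem.1 h), smul_zero]
  rw [setIntegral_congr_fun (measurableSet_Ioi.prod measurableSet_Ioo) hcongr,
    setIntegral_indicator (measurableSet_Ioo.prod measurableSet_Ioo),
    Set.inter_eq_self_of_subset_right
      (Set.prod_mono (Set.Ioo_subset_Ioi_self.trans (Set.Ioi_subset_Ioi hr)) subset_rfl),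
    Measure.volume_eq_prod, setIntegral_prod _ hint, intervalIntegral.integral_of_le hrR,
    integral_Ioc_eq_integral_Ioo]
  refine setIntegral_congr_fun measurableSet_Ioo fun ρ _ ↦ ?_
  have hper : Function.Periodic (fun θ : ℝ ↦ f (c + ρ * Complex.exp (θ * Complex.I)))
      (2 * Real.pi) := fun θ ↦ by
    simp only [Complex.ofReal_add, Complex.ofReal_mul, Complex.ofReal_ofNat]
    rw [add_mul, Complex.exp_periodic]
  have hshift := hper.intervalIntegral_add_eq (-Real.pi) 0
  rw [zero_add, show -Real.pi + 2 * Real.pi = Real.pi by ring,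
    intervalIntegral.integral_of_le (by linarith [Real.pi_pos]),
    integral_Ioc_eq_integral_Ioo] at hshift
  simp only [g]
  rw [integral_smul, hshift]

/-- For `x ∈ ℂ`, `r > 0` and a continuous nonnegative `u : ℂ → [0,∞)`,
there is `ρ ∈ (r, 2r)` with
`ρ² ∫₀^{2π} u(x + ρ e^{iθ}) dθ ≤ (log 2)⁻¹ ∫_{B(x,2r) \ B̄(x,r)} u dℒ²`. -/
theorem stmt_2 (x : ℂ) (r : ℝ) (hr : 0 < r) (u : ℂ → ℝ)
    (hu : Continuous u) (hu0 : ∀ z, 0 ≤ u z) :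
    ∃ ρ ∈ Set.Ioo r (2 * r),
      ρ ^ 2 * ∫ θ in (0:ℝ)..(2 * Real.pi), u (x + (ρ : ℂ) * Complex.exp (θ * Complex.I))
        ≤ (1 / Real.log 2) * ∫ z in Metric.ball x (2 * r) \ Metric.closedBall x r, u z := by
  by_contra! hlt
  have hr2 : r < 2 * r := by linarith
  have hpolar := Complex.setIntegral_annulus_eq_intervalIntegral hu x hr.le hr2.le
  simp only [smul_eq_mul] at hpolar
  set I := ∫ z in Metric.ball x (2 * r) \ Metric.closedBall x r, u z
  let F : ℝ → ℝ := fun ρ ↦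
    ∫ θ in (0:ℝ)..(2 * Real.pi), u (x + (ρ : ℂ) * Complex.exp (θ * Complex.I))
  have hF : Continuous F :=
    intervalIntegral.continuous_parametric_intervalIntegral_of_continuous' (by fun_prop) _ _
  have hlog : 0 < Real.log 2 := Real.log_pos one_lt_two
  have hcont : ContinuousOn (fun ρ : ℝ ↦ 1 / Real.log 2 * I * ρ⁻¹) (Set.Icc r (2 * r)) :=
    continuousOn_const.mul (continuousOn_id.inv₀ fun ρ hρ ↦ (hr.trans_le hρ.1).ne')
  have hpt : ∀ ρ ∈ Set.Ioo r (2 * r), 1 / Real.log 2 * I * ρ⁻¹ < ρ * F ρ := fun ρ hρ ↦ by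
    have hρ0 : 0 < ρ := hr.trans hρ.1
    rw [← div_eq_mul_inv, div_lt_iff₀ hρ0]
    calc 1 / Real.log 2 * I < ρ ^ 2 * F ρ := hlt ρ hρ
      _ = ρ * F ρ * ρ := by ring
  have hstrict : ∫ ρ in r..(2 * r), 1 / Real.log 2 * I * ρ⁻¹ < ∫ ρ in r..(2 * r), ρ * F ρ := by
    refine intervalIntegral.integral_lt_integral_of_ae_le_of_measure_setOfPred_lt_ne_zero hr2.le
      (hcont.intervalIntegrable_of_Icc hr2.le) ((continuous_id.mul hF).intervalIntegrable _ _)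
      ?_ fun h0 ↦ ?_
    · rw [← restrict_Ioo_eq_restrict_Ioc]
      exact (ae_restrict_mem measurableSet_Ioo).mono fun ρ hρ ↦ (hpt ρ hρ).le
    · rw [← restrict_Ioo_eq_restrict_Ioc] at h0
      have hsub : Set.Ioo r (2 * r) ⊆ {ρ | 1 / Real.log 2 * I * ρ⁻¹ < ρ * F ρ} := hpt
      have h1 := (Measure.le_restrict_apply (μ := volume) _ _).trans_eq h0
      rw [Set.inter_eq_self_of_subset_right hsub, Real.volume_Ioo] at h1
      simp only [nonpos_iff_eq_zero, ENNReal.ofReal_eq_zero] at h1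
      linarith
  rw [← hpolar, intervalIntegral.integral_const_mul, integral_inv_of_pos hr (by linarith),
    mul_div_cancel_right₀ _ hr.ne', one_div, mul_right_comm, inv_mul_cancel₀ hlog.ne',
    one_mul] at hstrict
  exact lt_irrefl I hstrict
end

section
/- Let f : ℂ → [0, ∞] be measurable and let 0 < r ≤ R. Then ∫_r^R ρ^{-1} ( ∫_{B(0,2ρ) \ B̄(0,ρ/2)} f dℒ² ) dρ ≤ log 4 · ∫_{B(0,2R) \ B̄(0,r/2)} f dℒ². -/
open MeasureTheory
open scoped ENNReal

/-- The logarithmic measure `dρ / ρ` of `(t / 2, 2 t)` is `log 4`. -/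
theorem lintegral_inv_Ioo_half_double {t : ℝ} (ht : 0 < t) :
    ∫⁻ ρ in Set.Ioo (t / 2) (2 * t), (ENNReal.ofReal ρ)⁻¹ = ENNReal.ofReal (Real.log 4) := by
  have hle : t / 2 ≤ 2 * t := by linarith
  have hint : IntervalIntegrable (fun ρ : ℝ => ρ⁻¹) volume (t / 2) (2 * t) := by
    refine intervalIntegral.intervalIntegrable_inv (fun ρ hρ => ?_) continuousOn_id
    rw [Set.uIcc_of_le hle] at hρ
    exact (lt_of_lt_of_le (by linarith) hρ.1).ne'
  have hlog : ∫ ρ in (t / 2)..(2 * t), ρ⁻¹ = Real.log 4 := by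
    rw [integral_inv_of_pos (by linarith) (by linarith)]
    congr 1
    field_simp
    norm_num
  rw [setLIntegral_congr (Ioo_ae_eq_Ioc (μ := volume)), ← hlog,
    intervalIntegral.integral_of_le hle, ofReal_integral_eq_lintegral_ofReal]
  · refine setLIntegral_congr_fun measurableSet_Ioc fun ρ hρ => ?_
    exact (ENNReal.ofReal_inv_of_pos (lt_trans (by linarith) hρ.1)).symm
  · exact (intervalIntegrable_iff_integrableOn_Ioc_of_le hle).1 hint
  · refine (ae_restrict_mem measurableSet_Ioc).mono fun ρ hρ => ?_
    exact inv_nonneg.2 (lt_trans (by linarith) hρ.1 : (0 : ℝ) < ρ).le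

/-- For measurable `f : ℂ → [0,∞]` and `0 < r ≤ R`,
`∫_r^R ρ⁻¹ (∫_{B(0,2ρ)∖B̄(0,ρ/2)} f dℒ²) dρ ≤ log 4 · ∫_{B(0,2R)∖B̄(0,r/2)} f dℒ²`. -/
theorem stmt_16 (f : ℂ → ℝ≥0∞) (hf : Measurable f) (r R : ℝ) (hr : 0 < r) (hrR : r ≤ R) :
    ∫⁻ ρ in Set.Ioc r R,
        (ENNReal.ofReal ρ)⁻¹ *
          ∫⁻ z in Metric.ball (0:ℂ) (2 * ρ) \ Metric.closedBall (0:ℂ) (ρ / 2), f z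
      ≤ ENNReal.ofReal (Real.log 4) *
          ∫⁻ z in Metric.ball (0:ℂ) (2 * R) \ Metric.closedBall (0:ℂ) (r / 2), f z := by
  set A : Set ℂ := Metric.ball (0:ℂ) (2 * R) \ Metric.closedBall (0:ℂ) (r / 2) with hA
  have hAm : MeasurableSet A := measurableSet_ball.diff measurableSet_closedBall
  let S : Set (ℝ × ℂ) := {p | ‖p.2‖ / 2 < p.1} ∩ {p | p.1 < 2 * ‖p.2‖}
  have hS : MeasurableSet S :=
    (measurableSet_lt (by fun_prop) (by fun_prop)).inter
      (measurableSet_lt (by fun_prop) (by fun_prop))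
  let g : ℝ × ℂ → ℝ≥0∞ := S.indicator fun p => (ENNReal.ofReal p.1)⁻¹ * f p.2
  have hg : Measurable g := Measurable.indicator (by fun_prop) hS
  calc
    _ ≤ ∫⁻ ρ in Set.Ioc r R, ∫⁻ z in A, g (ρ, z) := by
      refine setLIntegral_mono' measurableSet_Ioc fun ρ hρ => ?_
      rw [← lintegral_const_mul _ hf,
        ← lintegral_indicator (measurableSet_ball.diff measurableSet_closedBall),
        ← lintegral_indicator hAm]
      refine lintegral_mono fun z => Set.indicator_le (fun z hz => ?_) z
      simp only [Set.mem_sdiff, mem_ball_zero_iff, mem_closedBall_zero_iff, not_le] at hz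
      have hzA : z ∈ A := by
        simp only [hA, Set.mem_sdiff, mem_ball_zero_iff, mem_closedBall_zero_iff, not_le]
        constructor <;> linarith [hρ.1, hρ.2]
      have hzS : (ρ, z) ∈ S :=
        ⟨show ‖z‖ / 2 < ρ by linarith, show ρ < 2 * ‖z‖ by linarith⟩
      rw [Set.indicator_of_mem hzA]
      simp only [g, Set.indicator_of_mem hzS, le_refl]
    _ = ∫⁻ z in A, ∫⁻ ρ in Set.Ioc r R, g (ρ, z) :=
      lintegral_lintegral_swap hg.aemeasurable
    _ ≤ ∫⁻ z in A, ENNReal.ofReal (Real.log 4) * f z := by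
      refine setLIntegral_mono' hAm fun z hz => ?_
      have hz0 : 0 < ‖z‖ := by
        have := hz.2
        rw [mem_closedBall_zero_iff, not_le] at this
        linarith
      have hslice : (fun ρ => g (ρ, z)) = (Set.Ioo (‖z‖ / 2) (2 * ‖z‖)).indicator
          fun ρ => (ENNReal.ofReal ρ)⁻¹ * f z := rfl
      refine (setLIntegral_le_lintegral _ _).trans ?_
      rw [hslice, lintegral_indicator measurableSet_Ioo, lintegral_mul_const _ (by fun_prop),
        lintegral_inv_Ioo_half_double hz0]
    _ = _ := lintegral_const_mul _ hf
end
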